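/- There exists an MC-history H such that its rw-projection RW(H) is ACA but H itself is not ACA. (A witness is H = w_1[x] r_1^1[x] m_2^{1,1} c_1 c_2, in which reads(T_2, x, T_1, m_2^{1,1}) holds with m_2^{1,1} < c_1, while RW(H) = w_1[x] r_1^1[x] c_1 c_2 is ACA.) Hence the predicate of the ACA projection lemma is necessary. -/

import Mathlib

/-! ## Formalization of MC-transactions and MC-histories
(Pfeifer & Lockemann, "Theory and Practice of Transactional Method Caching") -/

/-- Types of operations: read, write, method, commit, abort. -/
inductive OpKind : Type where
  | r | w | m | c | a
deriving DecidableEq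

/-- Operations of MC-histories over data elements of type `D`:
`read i j x` is `r_i^j[x]`, `write i x` is `w_i[x]`, `meth i k l` is `m_i^{k,l}`,
`commit i` is `c_i` and `abort i` is `a_i`. -/
inductive MCOp (D : Type) : Type where
  | read  (i j : ℕ) (x : D)
  | write (i : ℕ) (x : D)
  | meth  (i k l : ℕ)
  | commit (i : ℕ)
  | abort (i : ℕ)

namespace MCOp
variable {D : Type}

/-- The index of the transaction an operation belongs to. -/
def tx : MCOp D → ℕ
  | read i _ _ => i
  | write i _ => i
  | meth i _ _ => i
  | commit i => i
  | abort i => i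

/-- The type `a(p)` of an operation. -/
def kind : MCOp D → OpKind
  | read _ _ _ => .r
  | write _ _ => .w
  | meth _ _ _ => .m
  | commit _ => .c
  | abort _ => .a

end MCOp

/-- The set `d(p)` of data elements of an operation (relative to a history's operation set,
which is needed for method operations). -/
def dset {D : Type} (ops : Set (MCOp D)) : MCOp D → Set D
  | .read _ _ x => {x}
  | .write _ x => {x}
  | .meth _ k l => {x | MCOp.read k l x ∈ ops}
  | .commit _ => ∅
  | .abort _ => ∅

/-- Two operations conflict (`u ∦ v`). -/
def conflict {D : Type} (ops : Set (MCOp D)) (p q : MCOp D) : Prop :=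
  (dset ops p ∩ dset ops q).Nonempty ∧
  ((p.tx ≠ q.tx ∧ (p.kind = OpKind.w ∨ q.kind = OpKind.w)) ∨
   (p.kind = OpKind.w ∧ q.kind = OpKind.m) ∨
   (p.kind = OpKind.m ∧ q.kind = OpKind.w))

theorem dset_nonmeth {D : Type} (ops1 ops2 : Set (MCOp D)) (p : MCOp D)
    (h : p.kind ≠ OpKind.m) : dset ops1 p = dset ops2 p := by
  cases p <;> simp [dset, MCOp.kind] at *

theorem conflict_nonmeth {D : Type} (ops1 ops2 : Set (MCOp D)) (p q : MCOp D)
    (hp : p.kind ≠ OpKind.m) (hq : q.kind ≠ OpKind.m) :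
    conflict ops1 p q → conflict ops2 p q := by
  rintro ⟨h1, h2⟩
  refine ⟨?_, h2⟩
  rwa [dset_nonmeth ops1 ops2 p hp, dset_nonmeth ops1 ops2 q hq] at h1

/-- A (well defined) MC-history `H` over MC-transactions `T_1, …, T_n`.
The transaction `T_i` is the set of operations `p ∈ ops` with `p.tx = i`;
`lt` is the partial order `<` of the history (by `lt_mem` it only relates
operations of the history and it restricts to the orders `<_i`). -/
structure MCHistory (D : Type) : Type where
  /-- number of transactions -/
  n : ℕ
  /-- the operations of the history -/
  ops : Set (MCOp D)
  /-- the partial ordering relation `<` -/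
  lt : MCOp D → MCOp D → Prop
  tx_mem : ∀ p ∈ ops, 1 ≤ p.tx ∧ p.tx ≤ n
  lt_irrefl : ∀ p, ¬ lt p p
  lt_trans : ∀ p q r, lt p q → lt q r → lt p r
  lt_mem : ∀ p q, lt p q → p ∈ ops ∧ q ∈ ops
  /-- `a_i ∈ T_i ↔ c_i ∉ T_i` -/
  abort_commit : ∀ i, 1 ≤ i → i ≤ n → (MCOp.abort i ∈ ops ↔ MCOp.commit i ∉ ops)
  /-- every non-termination operation precedes `a_i` or `c_i` -/
  terminate : ∀ p ∈ ops, p.kind ≠ OpKind.c → p.kind ≠ OpKind.a →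
      lt p (MCOp.abort p.tx) ∨ lt p (MCOp.commit p.tx)
  /-- `r_i^j[x] <_i w_i[x] ↔ ¬ (w_i[x] <_i r_i^j[x])` -/
  rw_order : ∀ (i j : ℕ) (x : D), MCOp.read i j x ∈ ops → MCOp.write i x ∈ ops →
      (lt (MCOp.read i j x) (MCOp.write i x) ↔ ¬ lt (MCOp.write i x) (MCOp.read i j x))
  /-- for `m_i^{k,l} ∈ H`, `k ∈ {1,…,n}` -/
  meth_range : ∀ i k l, MCOp.meth i k l ∈ ops → 1 ≤ k ∧ k ≤ n
  /-- for `m_i^{k,l} ∈ H`, every `r_k^l[x] ∈ H` satisfies `r_k^l[x] < m_i^{k,l}` -/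
  meth_reads : ∀ i k l, MCOp.meth i k l ∈ ops → ∀ x : D, MCOp.read k l x ∈ ops →
      lt (MCOp.read k l x) (MCOp.meth i k l)
  /-- well definedness: conflicting operations are ordered -/
  well_defined : ∀ p ∈ ops, ∀ q ∈ ops, conflict ops p q → lt p q ∨ lt q p

namespace MCHistory
variable {D : Type}

/-- The rw-projection `RW(H)`: all operations of `H` except method operations,
with the order restricted accordingly. -/
def RW (H : MCHistory D) : MCHistory D where
  n := H.n
  ops := {p | p ∈ H.ops ∧ p.kind ≠ OpKind.m}
  lt := fun p q => H.lt p q ∧ p.kind ≠ OpKind.m ∧ q.kind ≠ OpKind.m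
  tx_mem := fun p hp => H.tx_mem p hp.1
  lt_irrefl := fun p h => H.lt_irrefl p h.1
  lt_trans := fun p q r h1 h2 => ⟨H.lt_trans p q r h1.1 h2.1, h1.2.1, h2.2.2⟩
  lt_mem := fun p q h => ⟨⟨(H.lt_mem p q h.1).1, h.2.1⟩, (H.lt_mem p q h.1).2, h.2.2⟩
  abort_commit := by
    intro i h1 h2
    have h := H.abort_commit i h1 h2
    constructor
    · intro hp hc
      exact (h.mp hp.1) hc.1
    · intro hp
      refine ⟨h.mpr fun hc => hp ⟨hc, ?_⟩, ?_⟩ <;> simp [MCOp.kind]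
  terminate := by
    intro p hp hc ha
    rcases H.terminate p hp.1 hc ha with h | h
    · exact Or.inl ⟨h, hp.2, by simp [MCOp.kind]⟩
    · exact Or.inr ⟨h, hp.2, by simp [MCOp.kind]⟩
  rw_order := by
    intro i j x hr hw
    have h := H.rw_order i j x hr.1 hw.1
    constructor
    · intro hlt hlt2
      exact (h.mp hlt.1) hlt2.1
    · intro hlt
      refine ⟨h.mpr fun h2 => hlt ⟨h2, ?_, ?_⟩, ?_, ?_⟩ <;> simp [MCOp.kind]
  meth_range := by
    intro i k l hm
    exact absurd rfl hm.2
  meth_reads := by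
    intro i k l hm
    exact absurd rfl hm.2
  well_defined := by
    intro p hp q hq hc
    have hc' : conflict H.ops p q := conflict_nonmeth _ _ p q hp.2 hq.2 hc
    rcases H.well_defined p hp.1 q hq.1 hc' with h | h
    · exact Or.inl ⟨h, hp.2, hq.2⟩
    · exact Or.inr ⟨h, hq.2, hp.2⟩

/-- `reads(T_i, x, T_j, p)`: transaction `T_i` reads `x` from `T_j` via the operation `p`. -/
def readsVia (H : MCHistory D) (i : ℕ) (x : D) (j : ℕ) (p : MCOp D) : Prop :=
  ∃ h k : ℕ, MCOp.read h k x ∈ H.ops ∧ MCOp.write j x ∈ H.ops ∧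
    H.lt (MCOp.write j x) (MCOp.read h k x) ∧
    ((h = i ∧ p = MCOp.read h k x) ∨
      (h ≠ i ∧ MCOp.meth i h k ∈ H.ops ∧ p = MCOp.meth i h k)) ∧
    ¬ H.lt (MCOp.abort j) (MCOp.read h k x) ∧
    ∀ o : ℕ, MCOp.write o x ∈ H.ops → H.lt (MCOp.write j x) (MCOp.write o x) →
      H.lt (MCOp.write o x) (MCOp.read h k x) →
      H.lt (MCOp.abort o) (MCOp.read h k x)

/-- `H` is recoverable. -/
def Recoverable (H : MCHistory D) : Prop :=
  ∀ (i j : ℕ) (x : D) (p : MCOp D), i ≠ j → H.readsVia i x j p →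
    MCOp.commit i ∈ H.ops → H.lt (MCOp.commit j) (MCOp.commit i)

/-- `H` avoids cascading aborts (ACA). -/
def ACA (H : MCHistory D) : Prop :=
  ∀ (i j : ℕ) (x : D) (p : MCOp D), i ≠ j → H.readsVia i x j p →
    H.lt (MCOp.commit j) p

/-- `H` is strict. -/
def Strict (H : MCHistory D) : Prop :=
  H.ACA ∧ ∀ (i j : ℕ) (x : D), MCOp.write i x ∈ H.ops → MCOp.write j x ∈ H.ops →
    i ≠ j → H.lt (MCOp.write j x) (MCOp.write i x) →
    (H.lt (MCOp.abort j) (MCOp.write i x) ∨ H.lt (MCOp.commit j) (MCOp.write i x))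

/-- The 1-version serializability graph `SG(H)` of an rw-history. -/
def SG (H : MCHistory D) (i j : ℕ) : Prop :=
  i ≠ j ∧ MCOp.commit i ∈ H.ops ∧ MCOp.commit j ∈ H.ops ∧
  ∃ p q : MCOp D, p ∈ H.ops ∧ q ∈ H.ops ∧ p.tx = i ∧ q.tx = j ∧
    conflict H.ops p q ∧ H.lt p q

/-- The MC-serializability graph `MCSG(H)`. -/
def MCSG (H : MCHistory D) (i j : ℕ) : Prop :=
  MCOp.commit i ∈ H.ops ∧ MCOp.commit j ∈ H.ops ∧
  ((∃ p q : MCOp D, p ∈ H.ops ∧ q ∈ H.ops ∧ p.tx = i ∧ q.tx = j ∧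
      p.kind ≠ OpKind.m ∧ q.kind ≠ OpKind.m ∧ conflict H.ops p q ∧ H.lt p q) ∨
   (∃ (k l : ℕ) (x : D), MCOp.meth i k l ∈ H.ops ∧ MCOp.write j x ∈ H.ops ∧
      MCOp.read k l x ∈ H.ops ∧ H.lt (MCOp.read k l x) (MCOp.write j x) ∧
      (i ≠ j ∨ H.lt (MCOp.write j x) (MCOp.meth i k l))) ∨
   (i ≠ j ∧ ∃ (k l : ℕ) (x : D), MCOp.write i x ∈ H.ops ∧ MCOp.meth j k l ∈ H.ops ∧
      MCOp.read k l x ∈ H.ops ∧ H.lt (MCOp.write i x) (MCOp.read k l x)))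

/-- `ts` is a timestamp function for `H`: it assigns pairwise distinct
natural numbers to the transactions of `H`. -/
def TimestampFn (H : MCHistory D) (ts : ℕ → ℕ) : Prop :=
  ∀ i j : ℕ, 1 ≤ i → i ≤ H.n → 1 ≤ j → j ≤ H.n → ts i = ts j → i = j

/-- `H` is t-ordered w.r.t. `ts`. -/
def TOrdered (H : MCHistory D) (ts : ℕ → ℕ) : Prop :=
  ∀ p ∈ H.ops, ∀ q ∈ H.ops, conflict H.ops p q → ts p.tx < ts q.tx →
    (MCOp.abort p.tx ∈ H.ops ∨ MCOp.abort q.tx ∈ H.ops ∨ H.lt p q)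

/-- `H` is rm-ordered w.r.t. `ts`. -/
def RMOrdered (H : MCHistory D) (ts : ℕ → ℕ) : Prop :=
  ∀ (i j k l : ℕ) (x : D), MCOp.write i x ∈ H.ops → MCOp.meth j k l ∈ H.ops →
    MCOp.read k l x ∈ H.ops →
    H.lt (MCOp.write i x) (MCOp.read k l x) →
    H.lt (MCOp.read k l x) (MCOp.meth j k l) →
    (MCOp.abort i ∈ H.ops ∨ MCOp.abort j ∈ H.ops ∨ ts i < ts j)

/-- `H` is irreflexive. -/
def IrreflexiveHist (H : MCHistory D) : Prop :=
  ∀ (i k l : ℕ) (x : D), MCOp.write i x ∈ H.ops → MCOp.meth i k l ∈ H.ops →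
    MCOp.read k l x ∈ H.ops →
    H.lt (MCOp.read k l x) (MCOp.write i x) →
    H.lt (MCOp.write i x) (MCOp.meth i k l) →
    MCOp.abort i ∈ H.ops

/-- `tsfit` satisfies the defining recursion of the fitting timestamp function
`ts_fit` on the committed transactions of `H`. -/
def TsFitSpec (H : MCHistory D) (ts tsfit : ℕ → ℕ) : Prop :=
  ∀ i : ℕ, MCOp.commit i ∈ H.ops →
    tsfit i = sInf (({ts i} : Set ℕ) ∪
      {v : ℕ | ∃ j : ℕ, MCOp.commit j ∈ H.ops ∧ ts j < ts i ∧
        (∃ (k l : ℕ) (x : D), MCOp.write j x ∈ H.ops ∧ MCOp.meth i k l ∈ H.ops ∧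
          MCOp.read k l x ∈ H.ops ∧ H.lt (MCOp.read k l x) (MCOp.write j x)) ∧
        v = tsfit j})

/-- `H` is t-fitting w.r.t. `ts` (with fitting timestamps `tsfit`). -/
def TFitting (H : MCHistory D) (ts tsfit : ℕ → ℕ) : Prop :=
  ∀ i j : ℕ, H.MCSG i j → ts i < ts j → ts i < tsfit j

/-- A reverse edge of `MCSG(H)` w.r.t. `ts`. -/
def RevEdge (H : MCHistory D) (ts : ℕ → ℕ) (i j : ℕ) : Prop :=
  H.MCSG i j ∧ ts j < ts i

end MCHistory

/-- The position of an operation in the sequence `w_1[0] r_1^1[0] m_2^{1,1} c_1 c_2`,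
counted from one; operations that do not occur have position zero. -/
def uncommittedReadPos : MCOp ℕ → ℕ
  | .write 1 0 => 1
  | .read 1 1 0 => 2
  | .meth 2 1 1 => 3
  | .commit 1 => 4
  | .commit 2 => 5
  | _ => 0

theorem uncommittedReadPos_pos {p : MCOp ℕ} : 0 < uncommittedReadPos p ↔
    p = .write 1 0 ∨ p = .read 1 1 0 ∨ p = .meth 2 1 1 ∨ p = .commit 1 ∨ p = .commit 2 := by
  constructor
  · intro h
    unfold uncommittedReadPos at h
    split at h <;> simp_all
  · rintro (rfl | rfl | rfl | rfl | rfl) <;> simp [uncommittedReadPos]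

/-- The totally ordered MC-history `w_1[0] r_1^1[0] m_2^{1,1} c_1 c_2`. -/
def uncommittedReadHistory : MCHistory ℕ where
  n := 2
  ops := {p | 0 < uncommittedReadPos p}
  lt p q := 0 < uncommittedReadPos p ∧ uncommittedReadPos p < uncommittedReadPos q
  tx_mem p hp := by
    rcases uncommittedReadPos_pos.1 hp with rfl | rfl | rfl | rfl | rfl <;> simp [MCOp.tx]
  lt_irrefl p h := lt_irrefl _ h.2
  lt_trans p q r hpq hqr := ⟨hpq.1, hpq.2.trans hqr.2⟩
  lt_mem p q h := ⟨h.1, h.1.trans h.2⟩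
  abort_commit i h1 h2 := by
    interval_cases i <;> simp [uncommittedReadPos]
  terminate p hp hc ha := by
    rcases uncommittedReadPos_pos.1 hp with rfl | rfl | rfl | rfl | rfl <;>
      simp_all [MCOp.tx, MCOp.kind, uncommittedReadPos]
  rw_order i j x hr hw := by
    have hr' := uncommittedReadPos_pos.1 hr
    simp only [reduceCtorEq, MCOp.read.injEq, false_or, or_false] at hr'
    obtain ⟨rfl, rfl, rfl⟩ := hr'
    simp [uncommittedReadPos]
  meth_range i k l hm := by
    have hm' := uncommittedReadPos_pos.1 hm
    simp only [reduceCtorEq, MCOp.meth.injEq, false_or, or_false] at hm'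
    omega
  meth_reads i k l hm x hr := by
    have hm' := uncommittedReadPos_pos.1 hm
    have hr' := uncommittedReadPos_pos.1 hr
    simp only [reduceCtorEq, MCOp.meth.injEq, MCOp.read.injEq, false_or, or_false] at hm' hr'
    obtain ⟨rfl, rfl, rfl⟩ := hm'
    obtain ⟨-, -, rfl⟩ := hr'
    simp [uncommittedReadPos]
  well_defined p hp q hq h := by
    rcases uncommittedReadPos_pos.1 hp with rfl | rfl | rfl | rfl | rfl <;>
    rcases uncommittedReadPos_pos.1 hq with rfl | rfl | rfl | rfl | rfl <;>
      simp_all [conflict, MCOp.tx, MCOp.kind, uncommittedReadPos]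

theorem uncommittedReadHistory_rw_aca : uncommittedReadHistory.RW.ACA := by
  rintro i j x p hij ⟨h, k, hr, hw, -, hp, -⟩
  have hr' := uncommittedReadPos_pos.1 hr.1
  have hw' := uncommittedReadPos_pos.1 hw.1
  simp only [reduceCtorEq, MCOp.read.injEq, MCOp.write.injEq, false_or, or_false] at hr' hw'
  rcases hp with ⟨hi, -⟩ | ⟨-, hm, -⟩
  · omega
  · exact absurd rfl hm.2

theorem uncommittedReadHistory_not_aca : ¬ uncommittedReadHistory.ACA := by
  intro h
  have hreads : uncommittedReadHistory.readsVia 2 0 1 (.meth 2 1 1) := by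
    refine ⟨1, 1, ?_, ?_, ?_, Or.inr ⟨by decide, ?_, rfl⟩, ?_, fun o ho hlt => ?_⟩
    iterate 5 simp [uncommittedReadHistory, uncommittedReadPos]
    have ho' := uncommittedReadPos_pos.1 ho
    simp only [reduceCtorEq, MCOp.write.injEq, or_false] at ho'
    obtain ⟨rfl, -⟩ := ho'
    exact absurd hlt (uncommittedReadHistory.lt_irrefl _)
  have hlt := h 2 1 0 _ (by decide) hreads
  simp [uncommittedReadHistory, uncommittedReadPos] at hlt

/-- There exists an MC-history `H` whose rw-projection `RW(H)` is
ACA although `H` itself is not ACA (witnessed by `H_9 = w_1[x] r_1^1[x] m_2^{1,1} c_1 c_2`). -/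
theorem exists_rw_aca_not_aca :
    ∃ H : MCHistory ℕ, H.RW.ACA ∧ ¬ H.ACA := by
  exact ⟨uncommittedReadHistory, uncommittedReadHistory_rw_aca, uncommittedReadHistory_not_aca⟩
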